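/- Let l ≥ 1 and let b_0, b_1, ..., b_l be real numbers with b_j ≤ -2 for 0 ≤ j ≤ l. With the sequences (p_j), (q_j) defined by the alternative recursion, one has (b_0 + 1)q_{l-1} + p_{l-1} ≠ 0 and -((b_0 + 1)q_l + p_l)/((b_0 + 1)q_{l-1} + p_{l-1}) = ⟨b_l, b_{l-1}, ..., b_2, b_1 + 1⟩ (for l = 1 the right-hand side is ⟨b_1 + 1⟩ = b_1 + 1). -/

import Mathlib

/-- The continued fraction: `cfrac b m k = ⟨b_{m-k}, …, b_m⟩`, so that
`⟨b_j, …, b_m⟩ = cfrac b m (m - j)`, with `⟨b_m⟩ = b_m` and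
`⟨b_j, …, b_m⟩ = b_j - 1/⟨b_{j+1}, …, b_m⟩`. -/
noncomputable def cfrac (b : ℕ → ℝ) (m : ℕ) : ℕ → ℝ
  | 0 => b m
  | k + 1 => b (m - (k + 1)) - 1 / cfrac b m k

/-- Alternative recursion: `pA b (j+2) = p_j` with `p_{-2} = 0`, `p_{-1} = 1`,
`p_j = -b_j p_{j-1} - p_{j-2}`. -/
noncomputable def pA (b : ℕ → ℝ) : ℕ → ℝ
  | 0 => 0
  | 1 => 1
  | n + 2 => -b n * pA b (n + 1) - pA b n

/-- Alternative recursion: `qA b (j+2) = q_j` with `q_{-2} = -1`, `q_{-1} = 0`,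
`q_j = -b_j q_{j-1} - q_{j-2}`. -/
noncomputable def qA (b : ℕ → ℝ) : ℕ → ℝ
  | 0 => -1
  | 1 => 0
  | n + 2 => -b n * qA b (n + 1) - qA b n

/-- The combination `(b_0 + 1) q_n + p_n` is positive and nondecreasing in `n`. -/
lemma alt_comb_pos_and_le (b : ℕ → ℝ) (n : ℕ) (hb : ∀ j, j ≤ n + 1 → b j ≤ -2) :
    0 < (b 0 + 1) * qA b (n + 2) + pA b (n + 2) ∧
      (b 0 + 1) * qA b (n + 2) + pA b (n + 2) ≤ (b 0 + 1) * qA b (n + 3) + pA b (n + 3) := by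
  induction n with
  | zero =>
    have h := hb 1 le_rfl
    simp only [pA, qA]
    constructor <;> linarith
  | succ n ih =>
    obtain ⟨h0, h1⟩ := ih fun j hj => hb j (by omega)
    have h := hb (n + 2) le_rfl
    have hq : qA b (n + 4) = -b (n + 2) * qA b (n + 3) - qA b (n + 2) := rfl
    have hp : pA b (n + 4) = -b (n + 2) * pA b (n + 3) - pA b (n + 2) := rfl
    refine ⟨h0.trans_le h1, ?_⟩
    change (b 0 + 1) * qA b (n + 3) + pA b (n + 3) ≤ (b 0 + 1) * qA b (n + 4) + pA b (n + 4)
    rw [hq, hp]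
    nlinarith [mul_nonneg (h0.trans_le h1).le (by linarith : 0 ≤ -b (n + 2) - 2)]

/-- The tails of the reversed continued fraction are ratios of consecutive values of
`(b_0 + 1) q_n + p_n`. -/
lemma cfrac_reversed_tail (b : ℕ → ℝ) (n k : ℕ) (hk : k ≤ n)
    (hb : ∀ j, j ≤ n + 1 → b j ≤ -2) :
    cfrac (fun i => if i = n then b 1 + 1 else b (n + 1 - i)) n k =
      -((b 0 + 1) * qA b (k + 3) + pA b (k + 3)) /
        ((b 0 + 1) * qA b (k + 2) + pA b (k + 2)) := by
  induction k with
  | zero =>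
    simp only [cfrac, pA, qA, if_true]
    ring
  | succ k ih =>
    obtain ⟨h0, h1⟩ := alt_comb_pos_and_le b k fun j hj => hb j (by omega)
    have h2 := (h0.trans_le h1).ne'
    have h3 := h0.ne'
    have hq : qA b (k + 4) = -b (k + 2) * qA b (k + 3) - qA b (k + 2) := rfl
    have hp : pA b (k + 4) = -b (k + 2) * pA b (k + 3) - pA b (k + 2) := rfl
    have hne : n - (k + 1) ≠ n := by omega
    have hidx : n + 1 - (n - (k + 1)) = k + 2 := by omega
    rw [cfrac, ih (by omega), if_neg hne, hidx]
    change _ = -((b 0 + 1) * qA b (k + 4) + pA b (k + 4)) /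
      ((b 0 + 1) * qA b (k + 3) + pA b (k + 3))
    rw [hq, hp, one_div_div, div_neg, sub_neg_eq_add, eq_div_iff h2, add_mul,
      div_mul_cancel₀ _ h2]
    ring

/-- For real `b_0, …, b_l` with `b_j ≤ -2` for `0 ≤ j ≤ l`, `l ≥ 1`, and the alternative
recursion: `(b_0 + 1) q_{l-1} + p_{l-1} ≠ 0` and
`-((b_0 + 1) q_l + p_l) / ((b_0 + 1) q_{l-1} + p_{l-1}) = ⟨b_l, b_{l-1}, …, b_2, b_1 + 1⟩`.
The reversed sequence `b_l, b_{l-1}, …, b_2, b_1 + 1` has `l` entries, indexed `0, …, l-1`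
by `i ↦ b (l - i)` for `i < l - 1` and with last entry `b 1 + 1`; for `l = 1` the
right-hand side is just `b 1 + 1`. -/
theorem cf_alt_reversed (l : ℕ) (hl : 1 ≤ l) (b : ℕ → ℝ) (hb : ∀ j, j ≤ l → b j ≤ -2) :
    (b 0 + 1) * qA b (l + 1) + pA b (l + 1) ≠ 0 ∧
    -((b 0 + 1) * qA b (l + 2) + pA b (l + 2)) /
        ((b 0 + 1) * qA b (l + 1) + pA b (l + 1)) =
      cfrac (fun i => if i = l - 1 then b 1 + 1 else b (l - i)) (l - 1) (l - 1) := by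
  obtain ⟨n, rfl⟩ : ∃ n, l = n + 1 := ⟨l - 1, by omega⟩
  exact ⟨(alt_comb_pos_and_le b n hb).1.ne', (cfrac_reversed_tail b n n le_rfl hb).symm⟩
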